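/- Let η > η̄ and (β,γ) ∈ ℝ^p × ℝ_{++}^q. Set H₁ := ∇²_{ββ}L(β,γ) + ηI_p, H₂ := ∇²_{γγ}L(β,γ) + ηI_q, and C := ∇²_{γβ}L(β,γ) (the p×q cross-derivative block). Then the Schur complement satisfies H₂ − Cᵀ H₁⁻¹ C ⪰ (η − η̄) I_q in the positive semidefinite ordering; in particular its smallest eigenvalue is at least η − η̄ and it is invertible with ‖(H₂ − CᵀH₁⁻¹C)⁻¹‖ ≤ (η − η̄)⁻¹. -/

import Mathlib

open Matrix Real Filter Topology Bornology
open scoped Pointwise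

noncomputable section

abbrev Vec (k : ℕ) : Type := Fin k → ℝ

/-- Euclidean norm of a vector. -/
def eNorm {ι : Type*} [Fintype ι] (x : ι → ℝ) : ℝ := Real.sqrt (∑ j, (x j) ^ 2)

/-- Squared Euclidean norm of a pair of vectors. -/
def sqnorm2 {p q : ℕ} (w : Vec p × Vec q) : ℝ :=
  (∑ j, (w.1 j) ^ 2) + ∑ j, (w.2 j) ^ 2

/-- ℓ²→ℓ² operator norm of a matrix (its largest singular value). -/
def opNorm {ι κ : Type*} [Fintype ι] [Fintype κ] (M : Matrix ι κ ℝ) : ℝ :=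
  sInf {c : ℝ | 0 ≤ c ∧ ∀ x : κ → ℝ, eNorm (M.mulVec x) ≤ c * eNorm x}

/-- Smallest eigenvalue of a symmetric matrix, via Rayleigh quotients. -/
def minEig {ι : Type*} [Fintype ι] (M : Matrix ι ι ℝ) : ℝ :=
  sInf {r : ℝ | ∃ x : ι → ℝ, eNorm x = 1 ∧ r = x ⬝ᵥ M.mulVec x}

/-- Largest eigenvalue of a symmetric matrix, via Rayleigh quotients. -/
def maxEig {ι : Type*} [Fintype ι] (M : Matrix ι ι ℝ) : ℝ :=
  sSup {r : ℝ | ∃ x : ι → ℝ, eNorm x = 1 ∧ r = x ⬝ᵥ M.mulVec x}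

/-- The log-barrier (perspective of the negative log). -/
def phiBar (μ : ℝ) {q : ℕ} (γ : Vec q) : EReal :=
  if μ = 0 then (if ∀ j, 0 ≤ γ j then (0 : EReal) else ⊤)
  else if 0 < μ then
    (if ∀ j, 0 < γ j then (((-μ) * ∑ j, Real.log (γ j / μ) : ℝ) : EReal) else ⊤)
  else ⊤

/-- The coupling function κ_η. -/
def kappaFun (η : ℝ) {p q : ℕ} (w : Vec p × Vec q) : ℝ := η / 2 * sqnorm2 w

/-- 1-coercivity: liminf of F(w)/‖w‖ as ‖w‖ → ∞ is positive. -/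
def OneCoercive {p q : ℕ} (R : Vec p × Vec q → EReal) : Prop :=
  ∃ c : ℝ, 0 < c ∧ ∃ r : ℝ, ∀ w : Vec p × Vec q,
    r ≤ Real.sqrt (sqnorm2 w) → ((c * Real.sqrt (sqnorm2 w) : ℝ) : EReal) ≤ R w

/-- Data of a linear mixed-effects model. -/
structure LMEData (m p q : ℕ) where
  n : Fin m → ℕ
  X : ∀ i, Matrix (Fin (n i)) (Fin p) ℝ
  Z : ∀ i, Matrix (Fin (n i)) (Fin q) ℝ
  y : ∀ i, Fin (n i) → ℝ
  lam : ∀ i, Matrix (Fin (n i)) (Fin (n i)) ℝ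

namespace LMEData

variable {m p q : ℕ}

/-- Ω_i(Γ) = Z_i Γ Z_iᵀ + Λ_i. -/
def Omega (D : LMEData m p q) (Γ : Matrix (Fin q) (Fin q) ℝ) (i : Fin m) :
    Matrix (Fin (D.n i)) (Fin (D.n i)) ℝ :=
  D.Z i * Γ * (D.Z i)ᵀ + D.lam i

/-- The marginal negative log-likelihood L_ML(β, Γ). -/
def LML (D : LMEData m p q) (β : Vec p) (Γ : Matrix (Fin q) (Fin q) ℝ) : ℝ :=
  ∑ i, ((1 : ℝ) / 2 * ((D.y i - D.X i *ᵥ β) ⬝ᵥ ((D.Omega Γ i)⁻¹ *ᵥ (D.y i - D.X i *ᵥ β)))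
    + (1 : ℝ) / 2 * Real.log (D.Omega Γ i).det)

/-- L(β, γ) = L_ML(β, Diag γ). -/
def L (D : LMEData m p q) (β : Vec p) (γ : Vec q) : ℝ := D.LML β (Matrix.diagonal γ)

/-- ν = max_i (1/2) μ_min(Λ_i)^{-2} σ_max(Z_i)^4. -/
def nu (D : LMEData m p q) : ℝ :=
  ⨆ i : Fin m, (1 : ℝ) / 2 * ((minEig (D.lam i)) ^ 2)⁻¹ * (opNorm (D.Z i)) ^ 4

/-- η̄ = ν m. -/
def etabar (D : LMEData m p q) : ℝ := D.nu * m

/-- L_{η,μ}((β,γ),(β̃,γ̃)) = L(β,γ) + φ_μ(γ) + κ_η(β−β̃,γ−γ̃). -/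
def Lrelax (D : LMEData m p q) (η μ : ℝ) (x w : Vec p × Vec q) : EReal :=
  ((D.L x.1 x.2 + kappaFun η (x - w) : ℝ) : EReal) + phiBar μ x.2

/-- The optimal value function u_{η,μ} (with extended-real values). -/
def uval (D : LMEData m p q) (η μ : ℝ) (w : Vec p × Vec q) : EReal :=
  ⨅ x : Vec p × Vec q, D.Lrelax η μ x w

/-- The (real-valued) optimal value function u_{η,μ}. -/
def ufun (D : LMEData m p q) (η μ : ℝ) (w : Vec p × Vec q) : ℝ := (D.uval η μ w).toReal

/-- Partial gradient ∇_β L. -/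
def gradB (D : LMEData m p q) (β : Vec p) (γ : Vec q) : Vec p :=
  fun j => fderiv ℝ (fun b => D.L b γ) β (Pi.single j 1)

/-- Partial gradient ∇_γ L. -/
def gradG (D : LMEData m p q) (β : Vec p) (γ : Vec q) : Vec q :=
  fun j => fderiv ℝ (fun g => D.L β g) γ (Pi.single j 1)

/-- The map G_{η,μ}. -/
def Gmap (D : LMEData m p q) (η μ : ℝ) (x : Vec p × Vec q × Vec q) (w : Vec p × Vec q) :
    Vec p × Vec q × Vec q :=
  (D.gradB x.1 x.2.1 + η • (x.1 - w.1),
   D.gradG x.1 x.2.1 + η • (x.2.1 - w.2) - x.2.2,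
   fun j => x.2.2 j * x.2.1 j - μ)

/-- Second-derivative block ∇²_{ββ} L. -/
def hessBB (D : LMEData m p q) (β : Vec p) (γ : Vec q) : Matrix (Fin p) (Fin p) ℝ :=
  Matrix.of fun j k => fderiv ℝ (fun b => D.gradB b γ j) β (Pi.single k 1)

/-- Second-derivative block ∇²_{γγ} L. -/
def hessGG (D : LMEData m p q) (β : Vec p) (γ : Vec q) : Matrix (Fin q) (Fin q) ℝ :=
  Matrix.of fun j k => fderiv ℝ (fun g => D.gradG β g j) γ (Pi.single k 1)

/-- Second-derivative block ∇²_{γβ} L (the p×q cross block). -/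
def hessGB (D : LMEData m p q) (β : Vec p) (γ : Vec q) : Matrix (Fin p) (Fin q) ℝ :=
  Matrix.of fun j k => fderiv ℝ (fun g => D.gradB β g j) γ (Pi.single k 1)

/-- Second-derivative block ∇²_{βγ} L (the q×p cross block). -/
def hessBG (D : LMEData m p q) (β : Vec p) (γ : Vec q) : Matrix (Fin q) (Fin p) ℝ :=
  Matrix.of fun j k => fderiv ℝ (fun b => D.gradG b γ j) β (Pi.single k 1)

end LMEData

/-- f(r, M) = (1/2)(rᵀM⁻¹r + ln det M). -/
def fRM {n : ℕ} (r : Vec n) (M : Matrix (Fin n) (Fin n) ℝ) : ℝ :=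
  (1 : ℝ) / 2 * (r ⬝ᵥ (M⁻¹ *ᵥ r) + Real.log M.det)


lemma lineD {k : ℕ} {f : Vec k → ℝ} {x v : Vec k} {c : ℝ} (hf : DifferentiableAt ℝ f x)
    (h : HasDerivAt (fun t : ℝ => f (x + t • v)) c 0) : fderiv ℝ f x v = c := by
  rw [← hf.lineDeriv_eq_fderiv, lineDeriv]
  exact h.deriv

section NormSec
open scoped Matrix.Norms.Operator

def formCLM {n : ℕ} (u v : Fin n → ℝ) : Matrix (Fin n) (Fin n) ℝ →L[ℝ] ℝ :=
  LinearMap.toContinuousLinearMap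
    { toFun := fun A => u ⬝ᵥ (A *ᵥ v)
      map_add' := by intro A B; rw [Matrix.add_mulVec, dotProduct_add]
      map_smul' := by intro c B; rw [Matrix.smul_mulVec, dotProduct_smul]; rfl }

lemma formCLM_apply {n : ℕ} (u v : Fin n → ℝ) (A : Matrix (Fin n) (Fin n) ℝ) :
    formCLM u v A = u ⬝ᵥ (A *ᵥ v) := rfl

lemma inv_hasDerivAt {n : ℕ} (A B : Matrix (Fin n) (Fin n) ℝ) (hA : IsUnit A)
    (u v : Fin n → ℝ) :
    HasDerivAt (fun t : ℝ => u ⬝ᵥ ((A + t • B)⁻¹ *ᵥ v))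
      (-(u ⬝ᵥ ((A⁻¹ * B * A⁻¹) *ᵥ v))) 0 := by
  obtain ⟨a, rfl⟩ := hA
  have h1 : HasDerivAt (fun t : ℝ => (a : Matrix (Fin n) (Fin n) ℝ) + t • B) B 0 := by
    have := ((hasDerivAt_id (0:ℝ)).smul_const B).const_add (a : Matrix (Fin n) (Fin n) ℝ)
    rw [one_smul] at this
    exact this
  have h2 := hasFDerivAt_ringInverse (𝕜 := ℝ) a
  have h3 : HasFDerivAt Ring.inverse (-ContinuousLinearMap.mulLeftRight ℝ _ ↑a⁻¹ ↑a⁻¹)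
      ((a : Matrix (Fin n) (Fin n) ℝ) + (0:ℝ) • B) := by simpa using h2
  have h4 := (formCLM u v).hasFDerivAt.comp_hasDerivAt (0:ℝ) (h3.comp_hasDerivAt (0:ℝ) h1)
  have e : (fun t : ℝ => u ⬝ᵥ (((a : Matrix (Fin n) (Fin n) ℝ) + t • B)⁻¹ *ᵥ v)) =
      ⇑(formCLM u v) ∘ Ring.inverse ∘ fun t : ℝ => (a : Matrix (Fin n) (Fin n) ℝ) + t • B := by
    funext t
    simp [formCLM_apply, Matrix.nonsing_inv_eq_ringInverse]
  have e2 : -(u ⬝ᵥ (((a : Matrix (Fin n) (Fin n) ℝ)⁻¹ * B * (a : Matrix (Fin n) (Fin n) ℝ)⁻¹) *ᵥ v))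
      = (formCLM u v) ((-((ContinuousLinearMap.mulLeftRight ℝ (Matrix (Fin n) (Fin n) ℝ))
          ↑a⁻¹) ↑a⁻¹) B) := by
    rw [_root_.neg_apply, map_neg, formCLM_apply,
      ContinuousLinearMap.mulLeftRight_apply, Matrix.coe_units_inv]
  rw [e, e2]
  exact h4

lemma inv_differentiableAt {n k : ℕ} {F : Vec k → Matrix (Fin n) (Fin n) ℝ} {g : Vec k}
    (hF : ∀ a b, DifferentiableAt ℝ (fun g => F g a b) g) (hA : IsUnit (F g)) (u v : Fin n → ℝ) :
    DifferentiableAt ℝ (fun g => u ⬝ᵥ ((F g)⁻¹ *ᵥ v)) g := by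
  have h1 : DifferentiableAt ℝ F g := by
    have : F = fun g => ∑ a, ∑ b, F g a b • Matrix.single a b (1:ℝ) := by
      funext g
      conv_lhs => rw [Matrix.matrix_eq_sum_single (F g)]
      simp [Matrix.smul_single]
    rw [this]
    refine DifferentiableAt.fun_sum fun a _ => DifferentiableAt.fun_sum fun b _ => ?_
    exact (hF a b).smul_const _
  have h2 := (differentiableAt_inverse (𝕜 := ℝ) hA).comp g h1
  have h3 := ((formCLM u v).differentiableAt).comp g h2
  have e : (fun g => u ⬝ᵥ ((F g)⁻¹ *ᵥ v)) = ⇑(formCLM u v) ∘ Ring.inverse ∘ F := by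
    funext t
    simp [formCLM_apply, Matrix.nonsing_inv_eq_ringInverse]
  rw [e]
  exact h3

end NormSec

lemma det_differentiableAt {n k : ℕ} {F : Vec k → Matrix (Fin n) (Fin n) ℝ} {g : Vec k}
    (hF : ∀ a b, DifferentiableAt ℝ (fun g => F g a b) g) :
    DifferentiableAt ℝ (fun g => (F g).det) g := by
  simp only [Matrix.det_apply]
  refine DifferentiableAt.fun_sum fun s _ => ?_
  have h : DifferentiableAt ℝ (fun g => ∏ i, F g (s i) i) g :=
    by
    have := fun a => hF (s a) a
    fun_prop
  have e : (fun y => Equiv.Perm.sign s • ∏ i, F y (s i) i)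
      = fun y => ((Equiv.Perm.sign s : ℤ) : ℝ) * ∏ i, F y (s i) i := by
    funext y
    rw [Units.smul_def, zsmul_eq_mul]
  rw [e]
  exact h.const_mul _

lemma logdet_hasDerivAt {n : ℕ} (A : Matrix (Fin n) (Fin n) ℝ) (hA : A.det ≠ 0)
    (z : Fin n → ℝ) :
    HasDerivAt (fun t : ℝ => Real.log (A + t • vecMulVec z z).det) (z ⬝ᵥ (A⁻¹ *ᵥ z)) 0 := by
  have key : ∀ t : ℝ, (A + t • vecMulVec z z).det = A.det * (1 + t * (z ⬝ᵥ (A⁻¹ *ᵥ z))) := by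
    intro t
    have := Matrix.det_add_replicateCol_mul_replicateRow (ι := Unit) (A := A)
      (isUnit_iff_ne_zero.mpr hA) (t • z) z
    rw [← Matrix.vecMulVec_eq, Matrix.smul_vecMulVec] at this
    rw [this, Matrix.mul_assoc, ← Matrix.replicateCol_mulVec, Matrix.det_unique (n := Unit)]
    congr 1
    simp [Matrix.mul_apply, dotProduct, Matrix.mulVec_smul, Finset.mul_sum]
  simp only [key]
  have h1 : HasDerivAt (fun t : ℝ => A.det * (1 + t * (z ⬝ᵥ (A⁻¹ *ᵥ z))))
      (A.det * (z ⬝ᵥ (A⁻¹ *ᵥ z))) 0 := by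
    simpa using (((hasDerivAt_id (0:ℝ)).mul_const (z ⬝ᵥ (A⁻¹ *ᵥ z))).const_add 1).const_mul A.det
  have h2 := h1.log (by simpa using hA)
  convert h2 using 1
  simp [hA]

namespace LMEData
variable {m p q : ℕ}

/-- residual -/
def res (D : LMEData m p q) (b : Vec p) (i : Fin m) : Fin (D.n i) → ℝ := D.y i - D.X i *ᵥ b

/-- inverse covariance -/
def Si (D : LMEData m p q) (g : Vec q) (i : Fin m) : Matrix (Fin (D.n i)) (Fin (D.n i)) ℝ :=
  (D.Omega (Matrix.diagonal g) i)⁻¹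

lemma Om_posDef (D : LMEData m p q) (hlam : ∀ i, (D.lam i).PosDef) {g : Vec q}
    (hg : ∀ j, 0 < g j) (i : Fin m) : (D.Omega (Matrix.diagonal g) i).PosDef := by
  unfold Omega
  refine Matrix.PosDef.posSemidef_add ?_ (hlam i)
  have h := (Matrix.PosSemidef.diagonal (n := Fin q) (d := g) (fun j => (hg j).le))
  simpa using h.mul_mul_conjTranspose_same (D.Z i)

lemma Om_apply (D : LMEData m p q) (g : Vec q) (i : Fin m) (a b) :
    D.Omega (Matrix.diagonal g) i a b = ∑ j, D.Z i a j * g j * D.Z i b j + D.lam i a b := by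
  rw [Omega, Matrix.add_apply, Matrix.mul_apply]
  simp only [Matrix.mul_diagonal, Matrix.transpose_apply]

lemma Om_line (D : LMEData m p q) (g : Vec q) (i : Fin m) (k : Fin q) (t : ℝ) :
    D.Omega (Matrix.diagonal (g + t • Pi.single k 1)) i =
      D.Omega (Matrix.diagonal g) i + t • vecMulVec ((D.Z i)ᵀ k) ((D.Z i)ᵀ k) := by
  ext a b
  rw [Matrix.add_apply, Om_apply, Om_apply]
  simp only [Matrix.smul_apply, Matrix.vecMulVec_apply, Matrix.transpose_apply, Pi.add_apply, Pi.smul_apply, smul_eq_mul]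
  simp only [mul_add, add_mul, Finset.sum_add_distrib]
  have : ∑ j, D.Z i a j * (t * (Pi.single k (1:ℝ) : Vec q) j) * D.Z i b j
      = t * (D.Z i a k * D.Z i b k) := by
    rw [Finset.sum_eq_single k]
    · simp; ring
    · intro j _ hj; simp [hj]
    · simp
  rw [this]; ring

lemma Om_diff (D : LMEData m p q) (g : Vec q) (i : Fin m) (a b) :
    DifferentiableAt ℝ (fun g : Vec q => D.Omega (Matrix.diagonal g) i a b) g := by
  simp only [Om_apply]
  fun_prop

lemma Si_symm (D : LMEData m p q) (hlam : ∀ i, (D.lam i).PosDef) {g : Vec q}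
    (hg : ∀ j, 0 < g j) (i : Fin m) : (D.Si g i)ᵀ = D.Si g i := by
  have := (D.Om_posDef hlam hg i).inv.isHermitian
  simpa [Matrix.IsHermitian, Si] using this

lemma form_symm {n : ℕ} {A : Matrix (Fin n) (Fin n) ℝ} (hA : Aᵀ = A) (u v : Fin n → ℝ) :
    u ⬝ᵥ (A *ᵥ v) = v ⬝ᵥ (A *ᵥ u) := by
  rw [Matrix.dotProduct_mulVec, dotProduct_comm, ← Matrix.mulVec_transpose, hA]

lemma Si_line (D : LMEData m p q) (hlam : ∀ i, (D.lam i).PosDef) {g : Vec q}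
    (hg : ∀ j, 0 < g j) (i : Fin m) (k : Fin q) (u v : Fin (D.n i) → ℝ) :
    HasDerivAt (fun t : ℝ => u ⬝ᵥ (D.Si (g + t • Pi.single k 1) i *ᵥ v))
      (-((u ⬝ᵥ (D.Si g i *ᵥ (D.Z i)ᵀ k)) * ((D.Z i)ᵀ k ⬝ᵥ (D.Si g i *ᵥ v)))) 0 := by
  have h := inv_hasDerivAt (D.Omega (Matrix.diagonal g) i)
    (vecMulVec ((D.Z i)ᵀ k) ((D.Z i)ᵀ k)) (D.Om_posDef hlam hg i).isUnit u v
  have e : u ⬝ᵥ (((D.Omega (Matrix.diagonal g) i)⁻¹ * vecMulVec ((D.Z i)ᵀ k) ((D.Z i)ᵀ k)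
      * (D.Omega (Matrix.diagonal g) i)⁻¹) *ᵥ v)
      = (u ⬝ᵥ (D.Si g i *ᵥ (D.Z i)ᵀ k)) * ((D.Z i)ᵀ k ⬝ᵥ (D.Si g i *ᵥ v)) := by
    rw [← Matrix.mulVec_mulVec, ← Matrix.mulVec_mulVec, Matrix.vecMulVec_mulVec]
    simp only [Si, Matrix.mulVec_smul, dotProduct_smul, op_smul_eq_smul, smul_eq_mul]
    ring
  rw [e] at h
  simp only [Si, Om_line] at h ⊢
  exact h

lemma Si_diff (D : LMEData m p q) (hlam : ∀ i, (D.lam i).PosDef) {g : Vec q}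
    (hg : ∀ j, 0 < g j) (i : Fin m) (u v : Fin (D.n i) → ℝ) :
    DifferentiableAt ℝ (fun g => u ⬝ᵥ (D.Si g i *ᵥ v)) g :=
  inv_differentiableAt (fun a b => D.Om_diff g i a b) (D.Om_posDef hlam hg i).isUnit u v

lemma res_line (D : LMEData m p q) (b : Vec p) (i : Fin m) (j : Fin p) (t : ℝ) :
    D.res (b + t • Pi.single j 1) i = D.res b i - t • (D.X i)ᵀ j := by
  ext a
  simp [res, Matrix.mulVec_add, Matrix.mulVec_smul]
  ring

lemma L_eq (D : LMEData m p q) (b : Vec p) (g : Vec q) :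
    D.L b g = ∑ i, ((1 : ℝ) / 2 * (D.res b i ⬝ᵥ (D.Si g i *ᵥ D.res b i))
      + (1 : ℝ) / 2 * Real.log (D.Omega (Matrix.diagonal g) i).det) := rfl

lemma gradB_eq (D : LMEData m p q) (hlam : ∀ i, (D.lam i).PosDef) {g : Vec q}
    (hg : ∀ j, 0 < g j) (b : Vec p) (j : Fin p) :
    D.gradB b g j = ∑ i, -((D.X i)ᵀ j ⬝ᵥ (D.Si g i *ᵥ D.res b i)) := by
  unfold gradB
  refine lineD ?_ ?_
  · simp only [L_eq, res, dotProduct, Matrix.mulVec, Pi.sub_apply]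
    fun_prop
  · simp only [L_eq, res_line]
    refine HasDerivAt.fun_sum fun i _ => ?_
    have e : ∀ t : ℝ, (D.res b i - t • (D.X i)ᵀ j) ⬝ᵥ (D.Si g i *ᵥ (D.res b i - t • (D.X i)ᵀ j))
        = D.res b i ⬝ᵥ (D.Si g i *ᵥ D.res b i)
          + t * (-2 * ((D.X i)ᵀ j ⬝ᵥ (D.Si g i *ᵥ D.res b i)))
          + t * t * ((D.X i)ᵀ j ⬝ᵥ (D.Si g i *ᵥ (D.X i)ᵀ j)) := by
      intro t
      simp only [Matrix.mulVec_sub, Matrix.mulVec_smul, dotProduct_sub, sub_dotProduct,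
        dotProduct_smul, smul_dotProduct, smul_eq_mul]
      rw [form_symm (D.Si_symm hlam hg i) (D.res b i) ((D.X i)ᵀ j)]
      ring
    simp only [e]
    generalize D.res b i ⬝ᵥ (D.Si g i *ᵥ D.res b i) = c0
    generalize (D.X i)ᵀ j ⬝ᵥ (D.Si g i *ᵥ D.res b i) = c1
    generalize (D.X i)ᵀ j ⬝ᵥ (D.Si g i *ᵥ (D.X i)ᵀ j) = c2
    have h := hasDerivAt_id (0:ℝ)
    have h2 := ((((h.mul_const (-2 * c1)).const_add c0).add ((h.mul h).mul_const c2)).const_mul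
      ((1:ℝ)/2)).add_const ((1 : ℝ) / 2 * Real.log (D.Omega (Matrix.diagonal g) i).det)
    refine h2.congr_deriv ?_
    simp

lemma gradG_eq (D : LMEData m p q) (hlam : ∀ i, (D.lam i).PosDef) {g : Vec q}
    (hg : ∀ j, 0 < g j) (b : Vec p) (j : Fin q) :
    D.gradG b g j = ∑ i, ((1:ℝ) / 2 * (-((((D.Z i)ᵀ j ⬝ᵥ (D.Si g i *ᵥ D.res b i))) ^ 2))
      + (1:ℝ) / 2 * ((D.Z i)ᵀ j ⬝ᵥ (D.Si g i *ᵥ (D.Z i)ᵀ j))) := by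
  unfold gradG
  refine lineD ?_ ?_
  · simp only [L_eq]
    refine DifferentiableAt.fun_sum fun i _ => ?_
    refine ((D.Si_diff hlam hg i _ _).const_mul _).add (DifferentiableAt.const_mul ?_ _)
    exact (det_differentiableAt (fun a b => D.Om_diff g i a b)).log
      (D.Om_posDef hlam hg i).det_pos.ne'
  · simp only [L_eq]
    refine HasDerivAt.fun_sum fun i _ => ?_
    refine HasDerivAt.add ?_ ?_
    · have h := (D.Si_line hlam hg i j (D.res b i) (D.res b i)).const_mul ((1:ℝ)/2)
      refine h.congr_deriv ?_
      rw [form_symm (D.Si_symm hlam hg i) (D.res b i)]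
      ring
    · simp only [Om_line]
      exact (logdet_hasDerivAt _ (D.Om_posDef hlam hg i).det_pos.ne' _).const_mul _

lemma pos_eventually {g : Vec q} (hg : ∀ j, 0 < g j) : ∀ᶠ g' in 𝓝 g, ∀ j, 0 < g' j := by
  rw [eventually_all]
  intro j
  exact (continuous_apply j).continuousAt.eventually (lt_mem_nhds (hg j))

lemma hessBB_eq (D : LMEData m p q) (hlam : ∀ i, (D.lam i).PosDef) {g : Vec q}
    (hg : ∀ j, 0 < g j) (b : Vec p) :
    D.hessBB b g = ∑ i, (D.X i)ᵀ * D.Si g i * D.X i := by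
  ext j k
  have e : D.hessBB b g j k
      = ∑ i, (D.X i)ᵀ j ⬝ᵥ (D.Si g i *ᵥ (D.X i)ᵀ k) := by
    simp only [hessBB, Matrix.of_apply, D.gradB_eq hlam hg]
    refine lineD ?_ ?_
    · simp only [res, dotProduct, Matrix.mulVec, Pi.sub_apply]
      fun_prop
    · simp only [res_line]
      refine HasDerivAt.fun_sum fun i _ => ?_
      simp only [Matrix.mulVec_sub, Matrix.mulVec_smul, dotProduct_sub, dotProduct_smul,
        smul_eq_mul]
      have h := (((hasDerivAt_id (0:ℝ)).mul_const
        ((D.X i)ᵀ j ⬝ᵥ (D.Si g i *ᵥ (D.X i)ᵀ k))).const_sub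
        ((D.X i)ᵀ j ⬝ᵥ (D.Si g i *ᵥ D.res b i))).neg
      refine h.congr_deriv ?_
      simp
  rw [e, Matrix.sum_apply]
  refine Finset.sum_congr rfl fun i _ => ?_
  rw [Matrix.mul_assoc]
  simp only [dotProduct, Matrix.mulVec, Matrix.mul_apply, Matrix.transpose_apply]

lemma hessGB_eq (D : LMEData m p q) (hlam : ∀ i, (D.lam i).PosDef) {g : Vec q}
    (hg : ∀ j, 0 < g j) (b : Vec p) :
    D.hessGB b g = ∑ i, (D.X i)ᵀ * D.Si g i * (D.Z i * Matrix.diagonal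
      (fun k => (D.Z i)ᵀ k ⬝ᵥ (D.Si g i *ᵥ D.res b i))) := by
  ext j k
  have e : D.hessGB b g j k
      = ∑ i, ((D.X i)ᵀ j ⬝ᵥ (D.Si g i *ᵥ (D.Z i)ᵀ k)) *
        ((D.Z i)ᵀ k ⬝ᵥ (D.Si g i *ᵥ D.res b i)) := by
    simp only [hessGB, Matrix.of_apply]
    have ev : (fun g' => D.gradB b g' j) =ᶠ[𝓝 g]
        fun g' => ∑ i, -((D.X i)ᵀ j ⬝ᵥ (D.Si g' i *ᵥ D.res b i)) := by
      filter_upwards [pos_eventually hg] with g' hg'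
      exact D.gradB_eq hlam hg' b j
    rw [ev.fderiv_eq]
    refine lineD ?_ ?_
    · exact DifferentiableAt.fun_sum fun i _ => (D.Si_diff hlam hg i _ _).neg
    · refine HasDerivAt.fun_sum fun i _ => ?_
      refine (D.Si_line hlam hg i k _ _).neg.congr_deriv ?_
      simp
  rw [e, Matrix.sum_apply]
  refine Finset.sum_congr rfl fun i _ => ?_
  rw [← Matrix.mul_assoc, Matrix.mul_diagonal]
  congr 1
  rw [Matrix.mul_assoc]
  simp only [dotProduct, Matrix.mulVec, Matrix.mul_apply, Matrix.transpose_apply]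

lemma hessGG_eq (D : LMEData m p q) (hlam : ∀ i, (D.lam i).PosDef) {g : Vec q}
    (hg : ∀ j, 0 < g j) (b : Vec p) :
    D.hessGG b g = ∑ i, ((D.Z i * Matrix.diagonal
      (fun k => (D.Z i)ᵀ k ⬝ᵥ (D.Si g i *ᵥ D.res b i)))ᵀ * D.Si g i * (D.Z i * Matrix.diagonal
      (fun k => (D.Z i)ᵀ k ⬝ᵥ (D.Si g i *ᵥ D.res b i)))
      - (1/2 : ℝ) • Matrix.of fun j k => (((D.Z i)ᵀ * D.Si g i * D.Z i) j k) ^ 2) := by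
  ext j k
  have e : D.hessGG b g j k
      = ∑ i, (((D.Z i)ᵀ j ⬝ᵥ (D.Si g i *ᵥ D.res b i)) * ((D.Z i)ᵀ j ⬝ᵥ (D.Si g i *ᵥ (D.Z i)ᵀ k)) *
        ((D.Z i)ᵀ k ⬝ᵥ (D.Si g i *ᵥ D.res b i))
        - (1/2 : ℝ) * ((D.Z i)ᵀ j ⬝ᵥ (D.Si g i *ᵥ (D.Z i)ᵀ k)) ^ 2) := by
    simp only [hessGG, Matrix.of_apply]
    have ev : (fun g' => D.gradG b g' j) =ᶠ[𝓝 g]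
        fun g => ∑ i, ((1:ℝ) / 2 * (-((((D.Z i)ᵀ j ⬝ᵥ (D.Si g i *ᵥ D.res b i))) ^ 2))
          + (1:ℝ) / 2 * ((D.Z i)ᵀ j ⬝ᵥ (D.Si g i *ᵥ (D.Z i)ᵀ j))) := by
      filter_upwards [pos_eventually hg] with g' hg'
      exact D.gradG_eq hlam hg' b j
    rw [ev.fderiv_eq]
    refine lineD ?_ ?_
    · exact DifferentiableAt.fun_sum fun i _ =>
        (((D.Si_diff hlam hg i _ _).pow 2).neg.const_mul _).add
          ((D.Si_diff hlam hg i _ _).const_mul _)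
    · refine HasDerivAt.fun_sum fun i _ => ?_
      refine ((((D.Si_line hlam hg i k ((D.Z i)ᵀ j) (D.res b i)).pow 2).neg.const_mul _).add
        ((D.Si_line hlam hg i k ((D.Z i)ᵀ j) ((D.Z i)ᵀ j)).const_mul _)).congr_deriv ?_
      rw [form_symm (D.Si_symm hlam hg i) ((D.Z i)ᵀ k) ((D.Z i)ᵀ j)]
      simp
      ring
  rw [e, Matrix.sum_apply]
  refine Finset.sum_congr rfl fun i _ => ?_
  have e3 : ((D.Z i)ᵀ * D.Si g i * D.Z i) j k = ((D.Z i)ᵀ j ⬝ᵥ (D.Si g i *ᵥ (D.Z i)ᵀ k)) := by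
    rw [Matrix.mul_assoc]
    simp only [dotProduct, Matrix.mulVec, Matrix.mul_apply, Matrix.transpose_apply]
  rw [Matrix.sub_apply, Matrix.smul_apply, Matrix.of_apply, e3, Matrix.transpose_mul,
    Matrix.diagonal_transpose, ← Matrix.mul_assoc, Matrix.mul_diagonal, Matrix.mul_assoc,
    Matrix.mul_assoc, Matrix.diagonal_mul, ← Matrix.mul_assoc, e3, smul_eq_mul]

end LMEData

section LinAlg

lemma eNorm_nonneg {ι : Type*} [Fintype ι] (x : ι → ℝ) : 0 ≤ eNorm x := Real.sqrt_nonneg _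

lemma eNorm_sq {ι : Type*} [Fintype ι] (x : ι → ℝ) : eNorm x ^ 2 = x ⬝ᵥ x := by
  unfold eNorm
  rw [Real.sq_sqrt (Finset.sum_nonneg fun j _ => sq_nonneg _)]
  simp [dotProduct, sq]

lemma dot_le_eNorm {ι : Type*} [Fintype ι] (x y : ι → ℝ) : x ⬝ᵥ y ≤ eNorm x * eNorm y :=
  Real.sum_mul_le_sqrt_mul_sqrt _ _ _

lemma opNorm_nonempty {ι κ : Type*} [Fintype ι] [Fintype κ] (M : Matrix ι κ ℝ) :
    {c : ℝ | 0 ≤ c ∧ ∀ x : κ → ℝ, eNorm (M.mulVec x) ≤ c * eNorm x}.Nonempty := by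
  refine ⟨Real.sqrt (∑ i, ∑ j, M i j ^ 2), Real.sqrt_nonneg _, fun x => ?_⟩
  unfold eNorm
  have h0 : 0 ≤ ∑ i, ∑ j, M i j ^ 2 :=
    Finset.sum_nonneg fun i _ => Finset.sum_nonneg fun j _ => sq_nonneg _
  rw [← Real.sqrt_mul h0]
  refine Real.sqrt_le_sqrt ?_
  rw [Finset.sum_mul]
  exact Finset.sum_le_sum fun i _ => Finset.sum_mul_sq_le_sq_mul_sq _ _ _

lemma opNorm_nonneg' {ι κ : Type*} [Fintype ι] [Fintype κ] (M : Matrix ι κ ℝ) :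
    0 ≤ opNorm M := Real.sInf_nonneg fun _ h => h.1

lemma opNorm_le {ι κ : Type*} [Fintype ι] [Fintype κ] (M : Matrix ι κ ℝ) (x : κ → ℝ) :
    eNorm (M *ᵥ x) ≤ opNorm M * eNorm x := by
  rcases (eNorm_nonneg x).eq_or_lt with h | h
  · obtain ⟨c, _, hc⟩ := opNorm_nonempty M
    have := hc x
    rw [← h] at this ⊢
    simpa using this
  · rw [← div_le_iff₀ h]
    refine le_csInf (opNorm_nonempty M) fun c hc => ?_
    rw [div_le_iff₀ h]
    exact hc.2 x

lemma opNorm_transpose_le {ι κ : Type*} [Fintype ι] [Fintype κ] (M : Matrix ι κ ℝ) (v : ι → ℝ) :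
    eNorm (Mᵀ *ᵥ v) ≤ opNorm M * eNorm v := by
  rcases (eNorm_nonneg (Mᵀ *ᵥ v)).eq_or_lt with h | h
  · rw [← h]
    exact mul_nonneg (opNorm_nonneg' M) (eNorm_nonneg v)
  · have h1 : eNorm (Mᵀ *ᵥ v) ^ 2 = v ⬝ᵥ (M *ᵥ (Mᵀ *ᵥ v)) := by
      rw [eNorm_sq, Matrix.dotProduct_mulVec v, ← Matrix.mulVec_transpose]
    have h2 := dot_le_eNorm v (M *ᵥ (Mᵀ *ᵥ v))
    have h3 := mul_le_mul_of_nonneg_left (opNorm_le M (Mᵀ *ᵥ v)) (eNorm_nonneg v)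
    nlinarith

lemma minEig_le {n : ℕ} {A : Matrix (Fin n) (Fin n) ℝ} (hA : A.PosDef) (x : Fin n → ℝ) :
    minEig A * (x ⬝ᵥ x) ≤ x ⬝ᵥ (A *ᵥ x) := by
  rw [← eNorm_sq]
  rcases (eNorm_nonneg x).eq_or_lt with h | h
  · rw [← h]
    simpa using hA.posSemidef.dotProduct_mulVec_nonneg x
  · rw [← le_div_iff₀ (by positivity)]
    refine csInf_le ⟨0, ?_⟩ ⟨(eNorm x)⁻¹ • x, ?_, ?_⟩
    · rintro r ⟨y, _, rfl⟩
      simpa using hA.posSemidef.dotProduct_mulVec_nonneg y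
    · have : eNorm ((eNorm x)⁻¹ • x) ^ 2 = 1 := by
        rw [eNorm_sq, smul_dotProduct, dotProduct_smul, ← eNorm_sq, smul_eq_mul, smul_eq_mul]
        field_simp
      exact (pow_eq_one_iff_of_nonneg (eNorm_nonneg _) two_ne_zero).1 this
    · rw [Matrix.mulVec_smul, smul_dotProduct, dotProduct_smul, smul_eq_mul, smul_eq_mul]
      field_simp

lemma eNorm_single {n : ℕ} (j : Fin n) : eNorm (Pi.single j 1 : Fin n → ℝ) = 1 := by
  unfold eNorm
  rw [Finset.sum_eq_single j]
  · simp
  · intro k _ hk; simp [hk]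
  · simp

lemma minEig_pos {n : ℕ} (hn : 0 < n) {A : Matrix (Fin n) (Fin n) ℝ} (hA : A.PosDef) :
    0 < minEig A := by
  have hc : IsCompact {x : Fin n → ℝ | ∑ j, x j ^ 2 = 1} := by
    refine (isCompact_Icc (a := fun _ : Fin n => (-1:ℝ)) (b := fun _ => 1)).of_isClosed_subset ?_ ?_
    · exact isClosed_eq (by fun_prop) continuous_const
    · intro x hx
      have : ∀ j, x j ^ 2 ≤ 1 := fun j => by
        rw [← show ∑ j, x j ^ 2 = 1 from hx]
        exact Finset.single_le_sum (f := fun j => x j ^ 2) (fun _ _ => sq_nonneg _)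
          (Finset.mem_univ j)
      exact ⟨fun j => by have := this j; show -1 ≤ x j; nlinarith,
        fun j => by have := this j; show x j ≤ 1; nlinarith⟩
  have hiff : ∀ x : Fin n → ℝ, eNorm x = 1 ↔ ∑ j, x j ^ 2 = 1 := fun x => by
    unfold eNorm; rw [Real.sqrt_eq_one]
  have hne : {x : Fin n → ℝ | ∑ j, x j ^ 2 = 1}.Nonempty :=
    ⟨Pi.single ⟨0, hn⟩ 1, (hiff _).1 (eNorm_single _)⟩
  have hcont : Continuous fun x : Fin n → ℝ => x ⬝ᵥ (A *ᵥ x) := by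
    simp only [dotProduct, Matrix.mulVec]
    fun_prop
  obtain ⟨x0, hx0, hmin⟩ := hc.exists_isMinOn hne hcont.continuousOn
  have hx0ne : x0 ≠ 0 := by
    rintro rfl
    simp at hx0
  have hpos : 0 < x0 ⬝ᵥ (A *ᵥ x0) := by simpa using hA.dotProduct_mulVec_pos hx0ne
  refine hpos.trans_le (le_csInf ⟨_, x0, (hiff _).2 hx0, rfl⟩ ?_)
  rintro r ⟨y, hy, rfl⟩
  exact hmin ((hiff y).1 hy)

/-- lower bound on a form gives an upper bound on the inverse -/
lemma inv_bound {n : ℕ} {A : Matrix (Fin n) (Fin n) ℝ} (hA : IsUnit A) {c : ℝ} (hc : 0 < c)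
    (h : ∀ x, c * (x ⬝ᵥ x) ≤ x ⬝ᵥ (A *ᵥ x)) (v : Fin n → ℝ) :
    eNorm (A⁻¹ *ᵥ v) ≤ c⁻¹ * eNorm v := by
  have h1 := h (A⁻¹ *ᵥ v)
  rw [Matrix.mulVec_mulVec, Matrix.mul_nonsing_inv _ ((Matrix.isUnit_iff_isUnit_det _).1 hA),
    Matrix.one_mulVec, ← eNorm_sq] at h1
  have h2 := dot_le_eNorm (A⁻¹ *ᵥ v) v
  rw [inv_mul_eq_div, le_div_iff₀ hc]
  rcases (eNorm_nonneg (A⁻¹ *ᵥ v)).eq_or_lt with h | h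
  · rw [← h]
    simpa using eNorm_nonneg v
  · nlinarith

lemma schur_form {p q : ℕ} {H1 : Matrix (Fin p) (Fin p) ℝ} {H2 : Matrix (Fin q) (Fin q) ℝ}
    {C : Matrix (Fin p) (Fin q) ℝ} {c : ℝ} (hH1 : H1.PosDef)
    (hQ : ∀ b g, c * (g ⬝ᵥ g) ≤ b ⬝ᵥ (H1 *ᵥ b) + 2 * (b ⬝ᵥ (C *ᵥ g)) + g ⬝ᵥ (H2 *ᵥ g))
    (g : Fin q → ℝ) : c * (g ⬝ᵥ g) ≤ g ⬝ᵥ ((H2 - Cᵀ * H1⁻¹ * C) *ᵥ g) := by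
  have h := hQ (-(H1⁻¹ *ᵥ (C *ᵥ g))) g
  have e1 : H1 *ᵥ (-(H1⁻¹ *ᵥ (C *ᵥ g))) = -(C *ᵥ g) := by
    rw [Matrix.mulVec_neg, Matrix.mulVec_mulVec,
      Matrix.mul_nonsing_inv _ ((Matrix.isUnit_iff_isUnit_det _).1 hH1.isUnit), Matrix.one_mulVec]
  have e2 : g ⬝ᵥ ((Cᵀ * H1⁻¹ * C) *ᵥ g) = (H1⁻¹ *ᵥ (C *ᵥ g)) ⬝ᵥ (C *ᵥ g) := by
    rw [← Matrix.mulVec_mulVec, ← Matrix.mulVec_mulVec, Matrix.dotProduct_mulVec,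
      Matrix.vecMul_transpose, dotProduct_comm]
  rw [e1, neg_dotProduct_neg, neg_dotProduct] at h
  rw [Matrix.sub_mulVec, dotProduct_sub, e2]
  linarith

lemma final_bounds {q : ℕ} (hq : 0 < q) {M : Matrix (Fin q) (Fin q) ℝ} (hM : Mᵀ = M) {c : ℝ}
    (hc : 0 < c) (h : ∀ g, c * (g ⬝ᵥ g) ≤ g ⬝ᵥ (M *ᵥ g)) :
    Matrix.PosSemidef (M - c • (1 : Matrix (Fin q) (Fin q) ℝ)) ∧ c ≤ minEig M ∧ IsUnit M ∧
      ∀ x : Vec q, eNorm (M⁻¹ *ᵥ x) ≤ c⁻¹ * eNorm x := by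
  have hu : IsUnit M := by
    refine Matrix.PosDef.isUnit (Matrix.PosDef.of_dotProduct_mulVec_pos ?_ fun x hx => ?_)
    · simpa [Matrix.IsHermitian] using hM
    · rw [star_trivial]
      refine lt_of_lt_of_le (mul_pos hc ?_) (h x)
      have := Matrix.dotProduct_star_self_pos_iff (v := x) |>.2 hx
      simpa using this
  refine ⟨?_, ?_, hu, inv_bound hu hc h⟩
  · refine Matrix.PosSemidef.of_dotProduct_mulVec_nonneg ?_ fun x => ?_
    · simp [Matrix.IsHermitian, hM]
    · rw [star_trivial, Matrix.sub_mulVec, Matrix.smul_mulVec, Matrix.one_mulVec, dotProduct_sub,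
        dotProduct_smul, smul_eq_mul]
      linarith [h x]
  · refine le_csInf ⟨_, Pi.single ⟨0, hq⟩ 1, eNorm_single _, rfl⟩ ?_
    rintro r ⟨x, hx, rfl⟩
    have := h x
    rw [← eNorm_sq, hx] at this
    linarith

lemma hadamard_bound {q : ℕ} {B : Matrix (Fin q) (Fin q) ℝ} (hB : Bᵀ = B) {c : ℝ}
    (h : ∀ j, eNorm (B *ᵥ Pi.single j 1) ^ 2 ≤ c) (g : Fin q → ℝ) :
    g ⬝ᵥ ((Matrix.of fun j k => B j k ^ 2) *ᵥ g) ≤ c * (g ⬝ᵥ g) := by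
  have h' : ∀ j, ∑ k, B k j ^ 2 ≤ c := fun j => by
    have := h j
    rw [eNorm_sq] at this
    simpa [dotProduct, sq] using this
  have hs : ∀ j k, B j k = B k j := fun j k => by
    conv_lhs => rw [← hB]
    rfl
  have e1 : g ⬝ᵥ ((Matrix.of fun j k => B j k ^ 2) *ᵥ g) = ∑ j, ∑ k, g j * g k * B j k ^ 2 := by
    simp only [dotProduct, Matrix.mulVec, Matrix.of_apply, Finset.mul_sum]
    refine Finset.sum_congr rfl fun j _ => Finset.sum_congr rfl fun k _ => by ring
  have e2 : ∑ j, ∑ k, g j * g k * B j k ^ 2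
      ≤ ∑ j, ∑ k, (g j ^ 2 / 2 * B j k ^ 2 + g k ^ 2 / 2 * B j k ^ 2) := by
    refine Finset.sum_le_sum fun j _ => Finset.sum_le_sum fun k _ => ?_
    nlinarith [mul_nonneg (sq_nonneg (g j - g k)) (sq_nonneg (B j k))]
  have e3 : ∑ j, ∑ k, (g j ^ 2 / 2 * B j k ^ 2 + g k ^ 2 / 2 * B j k ^ 2)
      = ∑ j, g j ^ 2 * ∑ k, B k j ^ 2 := by
    simp only [Finset.sum_add_distrib]
    rw [Finset.sum_comm (f := fun j k => g k ^ 2 / 2 * B j k ^ 2), ← Finset.sum_add_distrib]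
    refine Finset.sum_congr rfl fun j _ => ?_
    rw [← Finset.sum_add_distrib, Finset.mul_sum]
    refine Finset.sum_congr rfl fun k _ => ?_
    rw [hs j k]; ring
  rw [e1]
  refine (e2.trans e3.le).trans ?_
  rw [dotProduct, Finset.mul_sum]
  refine Finset.sum_le_sum fun j _ => ?_
  nlinarith [h' j, sq_nonneg (g j)]

end LinAlg

namespace LMEData
variable {m p q : ℕ}

lemma Si_bound (D : LMEData m p q) (hn : ∀ i, 0 < D.n i) (hlam : ∀ i, (D.lam i).PosDef) {g : Vec q}
    (hg : ∀ j, 0 < g j) (i : Fin m) (v : Fin (D.n i) → ℝ) :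
    eNorm (D.Si g i *ᵥ v) ≤ (minEig (D.lam i))⁻¹ * eNorm v := by
  refine inv_bound (D.Om_posDef hlam hg i).isUnit (minEig_pos (hn i) (hlam i)) (fun x => ?_) v
  have h1 := minEig_le (hlam i) x
  have h := ((Matrix.PosSemidef.diagonal (n := Fin q) (d := g)
    (fun j => (hg j).le)).mul_mul_conjTranspose_same (D.Z i)).dotProduct_mulVec_nonneg x
  rw [star_trivial, Matrix.conjTranspose_eq_transpose_of_trivial] at h
  rw [Omega, Matrix.add_mulVec, dotProduct_add]
  linarith

lemma nu_bound (D : LMEData m p q) (hn : ∀ i, 0 < D.n i) (hlam : ∀ i, (D.lam i).PosDef) {g : Vec q}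
    (hg : ∀ j, 0 < g j) (i : Fin m) (v : Vec q) :
    (1/2 : ℝ) * (v ⬝ᵥ ((Matrix.of fun j k => (((D.Z i)ᵀ * D.Si g i * D.Z i) j k) ^ 2) *ᵥ v))
      ≤ D.nu * (v ⬝ᵥ v) := by
  have hB : ((D.Z i)ᵀ * D.Si g i * D.Z i)ᵀ = (D.Z i)ᵀ * D.Si g i * D.Z i := by
    rw [Matrix.transpose_mul, Matrix.transpose_mul, D.Si_symm hlam hg i, Matrix.transpose_transpose,
      Matrix.mul_assoc]
  have hmu := minEig_pos (hn i) (hlam i)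
  have h1 := hadamard_bound hB (c := ((minEig (D.lam i)) ^ 2)⁻¹ * (opNorm (D.Z i)) ^ 4)
    (fun j => ?_) v
  · have h2 : (1 : ℝ) / 2 * ((minEig (D.lam i)) ^ 2)⁻¹ * (opNorm (D.Z i)) ^ 4 ≤ D.nu :=
      le_ciSup (f := fun i : Fin m => (1 : ℝ) / 2 * ((minEig (D.lam i)) ^ 2)⁻¹
        * (opNorm (D.Z i)) ^ 4) (Set.finite_range _).bddAbove i
    have h3 : 0 ≤ v ⬝ᵥ v := by rw [← eNorm_sq]; positivity
    nlinarith [mul_le_mul_of_nonneg_right h2 h3]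
  · have h2 := opNorm_transpose_le (D.Z i) (D.Si g i *ᵥ (D.Z i *ᵥ Pi.single j 1))
    have h3 := D.Si_bound hn hlam hg i (D.Z i *ᵥ Pi.single j 1)
    have h4 := opNorm_le (D.Z i) (Pi.single j 1)
    rw [eNorm_single, mul_one] at h4
    have h0 := opNorm_nonneg' (D.Z i)
    have h5 : eNorm ((D.Z i)ᵀ *ᵥ (D.Si g i *ᵥ (D.Z i *ᵥ Pi.single j 1)))
        ≤ opNorm (D.Z i) * ((minEig (D.lam i))⁻¹ * opNorm (D.Z i)) :=
      h2.trans (mul_le_mul_of_nonneg_left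
        (h3.trans (mul_le_mul_of_nonneg_left h4 (inv_nonneg.2 hmu.le))) h0)
    rw [← Matrix.mulVec_mulVec, ← Matrix.mulVec_mulVec]
    refine (pow_le_pow_left₀ (eNorm_nonneg _) h5 2).trans (le_of_eq ?_)
    rw [← inv_pow]
    ring

lemma form_congr {n a b : ℕ} (U : Matrix (Fin n) (Fin a) ℝ) (A : Matrix (Fin n) (Fin n) ℝ)
    (V : Matrix (Fin n) (Fin b) ℝ) (x : Fin a → ℝ) (y : Fin b → ℝ) :
    x ⬝ᵥ ((Uᵀ * A * V) *ᵥ y) = (U *ᵥ x) ⬝ᵥ (A *ᵥ (V *ᵥ y)) := by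
  rw [← Matrix.mulVec_mulVec, ← Matrix.mulVec_mulVec, Matrix.dotProduct_mulVec,
    Matrix.vecMul_transpose]

lemma form_sum {a b : ℕ} (F : Fin m → Matrix (Fin a) (Fin b) ℝ) (x : Fin a → ℝ) (y : Fin b → ℝ) :
    x ⬝ᵥ ((∑ i, F i) *ᵥ y) = ∑ i, x ⬝ᵥ (F i *ᵥ y) := by
  rw [Matrix.sum_mulVec, dotProduct_sum]

lemma hess_form (D : LMEData m p q) (hn : ∀ i, 0 < D.n i) (hlam : ∀ i, (D.lam i).PosDef)
    {g : Vec q} (hg : ∀ j, 0 < g j) (b : Vec p) (x : Vec p) (v : Vec q) :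
    -(D.etabar * (v ⬝ᵥ v)) ≤ x ⬝ᵥ (D.hessBB b g *ᵥ x) + 2 * (x ⬝ᵥ (D.hessGB b g *ᵥ v))
      + v ⬝ᵥ (D.hessGG b g *ᵥ v) := by
  rw [D.hessBB_eq hlam hg, D.hessGB_eq hlam hg, D.hessGG_eq hlam hg, form_sum, form_sum, form_sum,
    Finset.mul_sum, ← Finset.sum_add_distrib, ← Finset.sum_add_distrib]
  have e : -(D.etabar * (v ⬝ᵥ v)) = ∑ i : Fin m, -(D.nu * (v ⬝ᵥ v)) := by
    simp [etabar]; ring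
  rw [e]
  refine Finset.sum_le_sum fun i _ => ?_
  have h1 := D.nu_bound hn hlam hg i v
  rw [Matrix.sub_mulVec, Matrix.smul_mulVec, dotProduct_sub, dotProduct_smul, smul_eq_mul,
    form_congr, form_congr, form_congr]
  have h2 := (D.Om_posDef hlam hg i).inv.posSemidef.dotProduct_mulVec_nonneg
    (D.X i *ᵥ x + (D.Z i * Matrix.diagonal
      (fun k => (D.Z i)ᵀ k ⬝ᵥ (D.Si g i *ᵥ D.res b i))) *ᵥ v)
  rw [star_trivial] at h2
  change 0 ≤ _ ⬝ᵥ (D.Si g i *ᵥ _) at h2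
  rw [Matrix.mulVec_add, dotProduct_add, add_dotProduct, add_dotProduct,
    form_symm (D.Si_symm hlam hg i) _ (D.X i *ᵥ x)] at h2
  have h3 := form_symm (D.Si_symm hlam hg i) (D.X i *ᵥ x) ((D.Z i * Matrix.diagonal
      (fun k => (D.Z i)ᵀ k ⬝ᵥ (D.Si g i *ᵥ D.res b i))) *ᵥ v)
  linarith

lemma hessBB_psd (D : LMEData m p q) (hlam : ∀ i, (D.lam i).PosDef)
    {g : Vec q} (hg : ∀ j, 0 < g j) (b : Vec p) : (D.hessBB b g).PosSemidef := by
  rw [D.hessBB_eq hlam hg]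
  refine Matrix.posSemidef_sum _ fun i _ => ?_
  simpa [Si] using (D.Om_posDef hlam hg i).inv.posSemidef.conjTranspose_mul_mul_same (D.X i)

lemma hessGG_symm (D : LMEData m p q) (hlam : ∀ i, (D.lam i).PosDef)
    {g : Vec q} (hg : ∀ j, 0 < g j) (b : Vec p) : (D.hessGG b g)ᵀ = D.hessGG b g := by
  rw [D.hessGG_eq hlam hg, Matrix.transpose_sum]
  refine Finset.sum_congr rfl fun i _ => ?_
  have hB : ((D.Z i)ᵀ * D.Si g i * D.Z i)ᵀ = (D.Z i)ᵀ * D.Si g i * D.Z i := by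
    rw [Matrix.transpose_mul, Matrix.transpose_mul, D.Si_symm hlam hg i, Matrix.transpose_transpose,
      Matrix.mul_assoc]
  rw [Matrix.transpose_sub]
  congr 1
  · generalize (D.Z i * Matrix.diagonal
      (fun k => (D.Z i)ᵀ k ⬝ᵥ (D.Si g i *ᵥ D.res b i))) = W
    rw [Matrix.transpose_mul, Matrix.transpose_mul, D.Si_symm hlam hg i, Matrix.transpose_transpose,
      Matrix.mul_assoc]
  · ext j k
    have := congrFun (congrFun hB j) k
    rw [Matrix.transpose_apply] at this
    simp only [Matrix.transpose_apply, Matrix.smul_apply, Matrix.of_apply, this]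

lemma etabar_nonneg (D : LMEData m p q) : 0 ≤ D.etabar := by
  refine mul_nonneg (Real.iSup_nonneg fun i => ?_) (Nat.cast_nonneg _)
  have := opNorm_nonneg' (D.Z i)
  positivity

end LMEData

/-- The Schur complement H₂ − Cᵀ H₁⁻¹ C satisfies
H₂ − CᵀH₁⁻¹C ⪰ (η − η̄) I; in particular its smallest eigenvalue is at least η − η̄
and it is invertible with ‖(H₂ − CᵀH₁⁻¹C)⁻¹‖ ≤ (η − η̄)⁻¹. -/
theorem schur_complement_lower_bound
    {m p q : ℕ} (hm : 0 < m) (hp : 0 < p) (hq : 0 < q)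
    (D : LMEData m p q) (hn : ∀ i, 0 < D.n i) (hlam : ∀ i, (D.lam i).PosDef)
    (η : ℝ) (hη : D.etabar < η)
    (β : Vec p) (γ : Vec q) (hγ : ∀ j, 0 < γ j) :
    Matrix.PosSemidef
      ((D.hessGG β γ + η • (1 : Matrix (Fin q) (Fin q) ℝ))
        - (D.hessGB β γ)ᵀ * (D.hessBB β γ + η • (1 : Matrix (Fin p) (Fin p) ℝ))⁻¹
            * D.hessGB β γ
        - (η - D.etabar) • (1 : Matrix (Fin q) (Fin q) ℝ)) ∧
    η - D.etabar ≤ minEig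
      ((D.hessGG β γ + η • (1 : Matrix (Fin q) (Fin q) ℝ))
        - (D.hessGB β γ)ᵀ * (D.hessBB β γ + η • (1 : Matrix (Fin p) (Fin p) ℝ))⁻¹
            * D.hessGB β γ) ∧
    IsUnit
      ((D.hessGG β γ + η • (1 : Matrix (Fin q) (Fin q) ℝ))
        - (D.hessGB β γ)ᵀ * (D.hessBB β γ + η • (1 : Matrix (Fin p) (Fin p) ℝ))⁻¹
            * D.hessGB β γ) ∧
    ∀ x : Vec q,
      eNorm (((D.hessGG β γ + η • (1 : Matrix (Fin q) (Fin q) ℝ))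
        - (D.hessGB β γ)ᵀ * (D.hessBB β γ + η • (1 : Matrix (Fin p) (Fin p) ℝ))⁻¹
            * D.hessGB β γ)⁻¹ *ᵥ x)
        ≤ (η - D.etabar)⁻¹ * eNorm x := by
  have hη0 : 0 < η := D.etabar_nonneg.trans_lt hη
  have hH1 : (D.hessBB β γ + η • (1 : Matrix (Fin p) (Fin p) ℝ)).PosDef :=
    Matrix.PosDef.posSemidef_add (D.hessBB_psd hlam hγ β) (Matrix.PosDef.one.smul hη0)
  have hH1s : (D.hessBB β γ + η • (1 : Matrix (Fin p) (Fin p) ℝ))⁻¹ᵀ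
      = (D.hessBB β γ + η • (1 : Matrix (Fin p) (Fin p) ℝ))⁻¹ := by
    simpa [Matrix.IsHermitian] using hH1.inv.isHermitian
  refine final_bounds hq ?_ (sub_pos.2 hη) (schur_form hH1 fun x v => ?_)
  · rw [Matrix.transpose_sub, Matrix.transpose_add, D.hessGG_symm hlam hγ, Matrix.transpose_mul,
      Matrix.transpose_mul, hH1s, Matrix.transpose_transpose, Matrix.mul_assoc]
    simp
  · have h := D.hess_form hn hlam hγ β x v
    have hx : 0 ≤ x ⬝ᵥ x := by rw [← eNorm_sq]; positivity
    rw [Matrix.add_mulVec, Matrix.add_mulVec, dotProduct_add, dotProduct_add, Matrix.smul_mulVec,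
      Matrix.smul_mulVec, Matrix.one_mulVec, Matrix.one_mulVec, dotProduct_smul, dotProduct_smul,
      smul_eq_mul, smul_eq_mul]
    nlinarith [mul_nonneg hη0.le hx]
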